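/- Let λ ≥ 2 be an integer and δ ≠ 0 a real number. Let f_a, f_b : [0,λ] → ℝ be continuous with f_a(0) = f_a(λ) = f_b(0) = f_b(λ), and let w ∈ {a,b}^ℕ be an infinite word such that the concatenation f = f_w is a solution of the integral equation (E_{λ,δ}). If f is not identically zero, then there exists a unique λ-uniform substitution σ on {a,b} such that σ(w) = w; moreover |σ(a)|_a = |σ(b)|_a, and for all x, y ∈ [0,λ] one has ∫_{λx}^{λy} f_{σ(a)}(t) dt = δ·(f_a(y) − f_a(x)) and ∫_{λx}^{λy} f_{σ(b)}(t) dt = δ·(f_b(y) − f_b(x)), where f_{σ(a)} and f_{σ(b)} are the concatenations along the finite words σ(a) and σ(b), defined on [0,λ²]. -/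

import Mathlib

open MeasureTheory

/-- The two-letter alphabet `{a, b}`. -/
inductive AB : Type
  | a : AB
  | b : AB
deriving DecidableEq

/-- `f` is a solution of the integral equation `(E_{λ,δ})` on `[0,∞)`:
it is continuous on `[0,∞)` and `∫₀^{λx} f = δ (f x - f 0)` for all `x ≥ 0`. -/
def IsSolution (lam δ : ℝ) (f : ℝ → ℝ) : Prop :=
  ContinuousOn f (Set.Ici 0) ∧
  ∀ x : ℝ, 0 ≤ x → (∫ t in (0:ℝ)..(lam * x), f t) = δ * (f x - f 0)

/-- Concatenation of `fa` and `fb` along the infinite word `w`: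
`f(nλ + x) = f_{wₙ}(x)` for `x ∈ [0,λ]`. -/
noncomputable def concatW (lam : ℝ) (fa fb : ℝ → ℝ) (w : ℕ → AB) (x : ℝ) : ℝ :=
  match w ⌊x / lam⌋₊ with
  | AB.a => fa (x - lam * (⌊x / lam⌋₊ : ℝ))
  | AB.b => fb (x - lam * (⌊x / lam⌋₊ : ℝ))

/-- Concatenation of `fa` and `fb` along a finite word `u`, defined on `[0, |u|·λ]`. -/
noncomputable def concatL (lam : ℝ) (fa fb : ℝ → ℝ) (u : List AB) (x : ℝ) : ℝ :=
  match u.getD ⌊x / lam⌋₊ AB.a with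
  | AB.a => fa (x - lam * (⌊x / lam⌋₊ : ℝ))
  | AB.b => fb (x - lam * (⌊x / lam⌋₊ : ℝ))

/-- The extension of a substitution `σ` to finite words. -/
def subL (σ : AB → List AB) (u : List AB) : List AB := u.flatMap σ

/-- The infinite word `w` is a fixed point of the substitution `σ` (`σ(w) = w`):
for every `n`, `σ(w₀ … w_{n-1})` is a prefix of `w`. -/
def SubFix (σ : AB → List AB) (w : ℕ → AB) : Prop :=
  ∀ n k : ℕ, k < (subL σ (List.ofFn fun i : Fin n => w i)).length →
    (subL σ (List.ofFn fun i : Fin n => w i)).getD k AB.a = w k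


def pickF (fa fb : ℝ → ℝ) : AB → ℝ → ℝ
  | AB.a => fa
  | AB.b => fb

lemma concatW_eq (lam : ℝ) (fa fb : ℝ → ℝ) (w : ℕ → AB) (x : ℝ) :
    concatW lam fa fb w x = pickF fa fb (w ⌊x / lam⌋₊) (x - lam * (⌊x / lam⌋₊ : ℝ)) := by
  unfold concatW
  cases w ⌊x / lam⌋₊ <;> rfl

lemma concatL_eq (lam : ℝ) (fa fb : ℝ → ℝ) (u : List AB) (x : ℝ) :
    concatL lam fa fb u x =
      pickF fa fb (u.getD ⌊x / lam⌋₊ AB.a) (x - lam * (⌊x / lam⌋₊ : ℝ)) := by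
  unfold concatL
  cases u.getD ⌊x / lam⌋₊ AB.a <;> rfl

lemma floor_block (lam : ℝ) (hl : 0 < lam) (n : ℕ) (s : ℝ) (h0 : 0 ≤ s) (h1 : s < lam) :
    ⌊(lam * n + s) / lam⌋₊ = n := by
  rw [Nat.floor_eq_iff (by positivity)]
  constructor
  · rw [le_div_iff₀ hl]; linarith [mul_comm lam (n:ℝ)]
  · rw [div_lt_iff₀ hl]; nlinarith

lemma exists_block (lam : ℝ) (hl : 0 < lam) (x : ℝ) (hx : 0 ≤ x) :
    ∃ n : ℕ, ∃ s : ℝ, 0 ≤ s ∧ s < lam ∧ x = lam * n + s := by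
  refine ⟨⌊x / lam⌋₊, x - lam * ⌊x / lam⌋₊, ?_, ?_, by ring⟩
  · have := Nat.floor_le (div_nonneg hx hl.le)
    rw [le_div_iff₀ hl] at this; linarith [mul_comm lam (⌊x / lam⌋₊:ℝ)]
  · have := Nat.lt_floor_add_one (x / lam)
    rw [div_lt_iff₀ hl] at this; linarith [mul_comm lam (⌊x / lam⌋₊:ℝ)]

lemma concatW_lt (lam : ℝ) (hl : 0 < lam) (fa fb : ℝ → ℝ) (w : ℕ → AB) (n : ℕ) (s : ℝ)
    (h0 : 0 ≤ s) (h1 : s < lam) :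
    concatW lam fa fb w (lam * n + s) = pickF fa fb (w n) s := by
  rw [concatW_eq, floor_block lam hl n s h0 h1]; congr 1; ring

lemma concatL_lt (lam : ℝ) (hl : 0 < lam) (fa fb : ℝ → ℝ) (u : List AB) (n : ℕ) (s : ℝ)
    (h0 : 0 ≤ s) (h1 : s < lam) :
    concatL lam fa fb u (lam * n + s) = pickF fa fb (u.getD n AB.a) s := by
  rw [concatL_eq, floor_block lam hl n s h0 h1]; congr 1; ring

section
variable {lam : ℝ} {fa fb : ℝ → ℝ}

lemma pick_zero (hb2 : fa 0 = fb 0) (c : AB) : pickF fa fb c 0 = fa 0 := by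
  cases c <;> simp [pickF, hb2]

lemma pick_lam (hb1 : fa 0 = fa lam) (hb3 : fa 0 = fb lam) (c : AB) :
    pickF fa fb c lam = fa 0 := by
  cases c
  · exact hb1.symm
  · exact hb3.symm

lemma concatW_le (hl : 0 < lam) (hb1 : fa 0 = fa lam) (hb2 : fa 0 = fb 0) (hb3 : fa 0 = fb lam)
    (w : ℕ → AB) (n : ℕ) (s : ℝ) (h0 : 0 ≤ s) (h1 : s ≤ lam) :
    concatW lam fa fb w (lam * n + s) = pickF fa fb (w n) s := by
  rcases h1.lt_or_eq with h | rfl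
  · exact concatW_lt lam hl fa fb w n s h0 h
  · have := concatW_lt s hl fa fb w (n+1) 0 le_rfl hl
    rw [pick_zero hb2] at this
    rw [pick_lam hb1 hb3, ← this]; congr 1; push_cast; ring
end

lemma periodic_const (lam : ℕ) (hlam : 2 ≤ lam) (δ : ℝ) (hδ : δ ≠ 0) (f : ℝ → ℝ)
    (hsol : IsSolution (lam : ℝ) δ f) (hper : ∀ x, 0 ≤ x → f (x + lam) = f x) :
    ∀ x, 0 ≤ x → f x = 0 := by
  obtain ⟨hc, hE⟩ := hsol
  have hl : (0:ℝ) < lam := by positivity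
  have hint : ∀ a b : ℝ, 0 ≤ a → 0 ≤ b → IntervalIntegrable f volume a b := by
    intro a b ha hb
    apply ContinuousOn.intervalIntegrable
    apply hc.mono
    intro x hx
    exact le_trans (le_min ha hb) hx.1
  have iter : ∀ (p c : ℝ), 0 ≤ p → (∀ x, 0 ≤ x → f (x + p) = f x + c) →
      ∀ (k : ℕ) x, 0 ≤ x → f (x + k * p) = f x + k * c := by
    intro p c hp h k x hx
    induction k with
    | zero => simp
    | succ k ih =>
      have := h (x + k * p) (by positivity)
      rw [ih] at this
      push_cast
      rw [show x + ((k:ℝ) + 1) * p = x + k * p + p by ring, this]; ring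
  have step : ∀ p : ℝ, 0 < p → (∀ x, 0 ≤ x → f (x + p) = f x) →
      (∀ x, 0 ≤ x → f (x + p / lam) = f x) := by
    intro p hp h
    set C := (∫ t in (0:ℝ)..p, f t) / δ with hC
    have h1 : ∀ x, 0 ≤ x → f (x + p / lam) = f x + C := by
      intro x hx
      have e1 := hE x hx
      have e2 := hE (x + p / lam) (by positivity)
      rw [show (lam:ℝ) * (x + p / lam) = lam * x + p by field_simp] at e2
      have hx' : 0 ≤ lam * x := by positivity
      have e3 := intervalIntegral.integral_add_adjacent_intervals
        (hint 0 p le_rfl hp.le) (hint p (lam * x + p) hp.le (by positivity))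
      have e4 : ∫ t in p..(lam * x + p), f t = ∫ t in (0:ℝ)..(lam * x), f t := by
        have := intervalIntegral.integral_comp_add_right (a := 0) (b := lam * x) f p
        rw [zero_add] at this
        rw [← this]
        apply intervalIntegral.integral_congr
        intro t ht
        rw [Set.uIcc_of_le hx'] at ht
        exact h t ht.1
      have e5 : δ * C = ∫ t in (0:ℝ)..p, f t := by rw [hC]; field_simp
      have : δ * f (x + p / lam) = δ * (f x + C) := by
        rw [mul_add, e5]; linarith
      exact mul_left_cancel₀ hδ this
    have h2 := iter (p / lam) C (by positivity) h1 lam 0 le_rfl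
    rw [show 0 + (lam:ℝ) * (p / lam) = 0 + p by field_simp, h 0 le_rfl] at h2
    have : C = 0 := by
      have : (lam:ℝ) * C = 0 := by linarith
      rcases mul_eq_zero.1 this with h | h
      · exact absurd h hl.ne'
      · exact h
    intro x hx
    rw [h1 x hx, this, add_zero]
  have hall : ∀ n : ℕ, ∀ x, 0 ≤ x → f (x + lam / (lam:ℝ) ^ n) = f x := by
    intro n
    induction n with
    | zero => simpa using hper
    | succ n ih =>
      have := step _ (by positivity) ih
      intro x hx
      rw [pow_succ, ← div_div]; exact this x hx
  have hconst : ∀ x, 0 ≤ x → f x = f 0 := by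
    intro x hx
    have hc0 : ContinuousWithinAt f (Set.Ici 0) 0 := hc 0 (by simp)
    rw [Metric.continuousWithinAt_iff] at hc0
    by_contra hne
    obtain ⟨d, hd, hdd⟩ := hc0 (dist (f x) (f 0)) (dist_pos.2 hne)
    obtain ⟨n, hn⟩ := pow_unbounded_of_one_lt ((lam:ℝ) / d) (show (1:ℝ) < lam by exact_mod_cast hlam)
    have hp : (0:ℝ) < lam / (lam:ℝ)^n := by positivity
    obtain ⟨k, s, hs0, hs1, hxs⟩ := exists_block _ hp x hx
    have h3 := iter _ 0 hp.le (by simpa using hall n) k s hs0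
    have : f x = f s := by rw [hxs, add_comm, mul_comm, h3]; ring
    have h4 := hdd (x := s) hs0 (by
      rw [Real.dist_eq, sub_zero, abs_of_nonneg hs0]
      refine hs1.trans ?_
      rw [div_lt_iff₀ (by positivity)]
      rw [div_lt_iff₀ hd] at hn
      linarith)
    rw [this] at h4
    exact lt_irrefl _ h4
  have := hE 1 zero_le_one
  rw [hconst 1 zero_le_one, sub_self, mul_zero, mul_one,
    intervalIntegral.integral_congr (g := fun _ => f 0)] at this
  · simp at this
    intro x hx
    rw [hconst x hx]
    rcases this with h | h
    · omega
    · exact h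
  · intro t ht
    rw [Set.uIcc_of_le hl.le] at ht
    exact hconst t ht.1

lemma subL_ofFn (lam : ℕ) (σ : AB → List AB) (h : ∀ c, (σ c).length = lam) (w : ℕ → AB) (n : ℕ) :
    (subL σ (List.ofFn fun i : Fin n => w i)).length = lam * n ∧
    ∀ m < n, ∀ i < lam, (subL σ (List.ofFn fun i : Fin n => w i)).getD (lam * m + i) AB.a
      = (σ (w m)).getD i AB.a := by
  induction n with
  | zero => simp [subL]
  | succ n ih =>
    have key : subL σ (List.ofFn fun i : Fin (n+1) => w i)
        = subL σ (List.ofFn fun i : Fin n => w i) ++ σ (w n) := by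
      simp only [subL]
      rw [List.ofFn_succ', List.concat_eq_append, List.flatMap_append]
      simp
    rw [key]
    refine ⟨by rw [List.length_append, ih.1, h]; ring, ?_⟩
    intro m hm i hi
    rcases Nat.lt_succ_iff_lt_or_eq.1 hm with h1 | rfl
    · rw [List.getD_append _ _ _ _ (by rw [ih.1]; nlinarith), ih.2 m h1 i hi]
    · rw [List.getD_append_right _ _ _ _ (by rw [ih.1]; omega), ih.1]
      congr 1; omega

lemma subFix_iff (lam : ℕ) (hl : 0 < lam) (σ : AB → List AB) (h : ∀ c, (σ c).length = lam)
    (w : ℕ → AB) : SubFix σ w ↔ ∀ n, ∀ i < lam, (σ (w n)).getD i AB.a = w (lam * n + i) := by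
  constructor
  · intro hs n i hi
    have := subL_ofFn lam σ h w (n+1)
    rw [← this.2 n (by omega) i hi]
    exact hs (n+1) _ (by rw [this.1]; nlinarith)
  · intro hs n k hk
    have := subL_ofFn lam σ h w n
    rw [this.1] at hk
    have e : lam * (k / lam) + k % lam = k := Nat.div_add_mod k lam
    have h1 : k / lam < n := Nat.div_lt_of_lt_mul hk
    have h2 := this.2 _ h1 _ (Nat.mod_lt k hl)
    rw [e] at h2
    rw [h2, hs _ _ (Nat.mod_lt k hl), e]

lemma count_getD (u : List AB) : (u.count AB.a : ℝ)
    = ∑ i ∈ Finset.range u.length, if u.getD i AB.a = AB.a then (1:ℝ) else 0 := by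
  induction u with
  | nil => simp
  | cons c u ih =>
    rw [List.length_cons, Finset.sum_range_succ', List.count_cons]
    simp only [List.getD_cons_succ, List.getD_cons_zero]
    push_cast
    rw [ih]
    cases c <;> simp

lemma ext_getD (u v : List AB) (h : u.length = v.length)
    (h2 : ∀ i < u.length, u.getD i AB.a = v.getD i AB.a) : u = v := by
  apply List.ext_getElem h
  intro i h3 h4
  have := h2 i h3
  rwa [List.getD_eq_getElem _ _ h3, List.getD_eq_getElem _ _ h4] at this

lemma zero_of_moments (L : ℝ) (hL : 0 < L) (g : ℝ → ℝ) (hg : Continuous g)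
    (hM : ∀ n : ℕ, ∫ t in (0:ℝ)..L, t ^ n * g t = 0) : ∀ t ∈ Set.Icc 0 L, g t = 0 := by
  have hpoly : ∀ p : Polynomial ℝ, ∫ t in (0:ℝ)..L, p.eval t * g t = 0 := by
    intro p
    induction p using Polynomial.induction_on' with
    | add p q hp hq =>
      simp only [Polynomial.eval_add, add_mul]
      rw [intervalIntegral.integral_add, hp, hq, add_zero]
      · exact (p.continuous.mul hg).intervalIntegrable _ _
      · exact (q.continuous.mul hg).intervalIntegrable _ _
    | monomial n a =>
      simp only [Polynomial.eval_monomial, mul_assoc]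
      rw [intervalIntegral.integral_const_mul, hM, mul_zero]
  set K := ∫ t in (0:ℝ)..L, |g t| with hK
  have hK0 : 0 ≤ K := intervalIntegral.integral_nonneg hL.le (fun t _ => abs_nonneg _)
  have hsq : ∫ t in (0:ℝ)..L, g t * g t = 0 := by
    apply le_antisymm
    · apply le_of_forall_pos_le_add
      intro ε hε
      obtain ⟨p, hp⟩ := exists_polynomial_near_of_continuousOn 0 L g hg.continuousOn
        (ε / (K + 1)) (by positivity)
      have e : ∫ t in (0:ℝ)..L, g t * g t = ∫ t in (0:ℝ)..L, (g t - p.eval t) * g t := by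
        simp only [sub_mul]
        rw [intervalIntegral.integral_sub, hpoly, sub_zero]
        · exact (hg.mul hg).intervalIntegrable _ _
        · exact (p.continuous.mul hg).intervalIntegrable _ _
      rw [e, zero_add]
      calc ∫ t in (0:ℝ)..L, (g t - p.eval t) * g t
          ≤ ∫ t in (0:ℝ)..L, (ε / (K+1)) * |g t| := by
            apply intervalIntegral.integral_mono_on hL.le
            · exact (((hg.sub p.continuous).mul hg)).intervalIntegrable _ _
            · exact (continuous_const.mul hg.abs).intervalIntegrable _ _
            · intro t ht
              have h1 := hp t ht
              rw [abs_sub_comm] at h1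
              calc (g t - p.eval t) * g t ≤ |(g t - p.eval t) * g t| := le_abs_self _
                _ = |g t - p.eval t| * |g t| := abs_mul _ _
                _ ≤ _ := by gcongr
        _ = ε / (K+1) * K := by rw [intervalIntegral.integral_const_mul]
        _ ≤ ε := by
          rw [div_mul_eq_mul_div, div_le_iff₀ (by positivity)]; nlinarith
    · exact intervalIntegral.integral_nonneg hL.le (fun t _ => mul_self_nonneg _)
  by_contra hne
  push Not at hne
  obtain ⟨t, ht, hgt⟩ := hne
  have := intervalIntegral.integral_pos hL (f := fun t => g t * g t) (hg.mul hg).continuousOn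
    (fun t _ => mul_self_nonneg _) ⟨t, ht, mul_self_pos.2 hgt⟩
  linarith

lemma sum_zero (lam : ℕ) (hlam : 2 ≤ lam) (δ : ℝ) (g : ℝ → ℝ) (hg : Continuous g)
    (hg0 : ∀ t ≤ 0, g t = 0) (hg1 : ∀ t, (lam:ℝ) ≤ t → g t = 0) (D : ℕ → ℝ)
    (hE : ∀ y ∈ Set.Icc (0:ℝ) lam,
      ∫ t in (0:ℝ)..(lam * y), ∑ i ∈ Finset.range lam, D i * g (t - lam * i) = δ * g y)
    (hD : ∑ i ∈ Finset.range lam, D i ≠ 0) : ∀ t ∈ Set.Icc (0:ℝ) lam, g t = 0 := by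
  have hl : (0:ℝ) < lam := by positivity
  apply zero_of_moments lam hl g hg
  intro N
  induction N using Nat.strong_induction_on with
  | _ N ih =>
  set h : ℝ → ℝ := fun t => ∑ i ∈ Finset.range lam, D i * g (t - lam * i) with hh
  have hhc : Continuous h := by
    rw [hh]; fun_prop
  -- step A
  have A : ∫ t in (0:ℝ)..(lam * lam), t ^ N * h t
      = ∑ i ∈ Finset.range lam, D i * ∫ s in (0:ℝ)..lam, (s + lam * i) ^ N * g s := by
    simp only [hh, Finset.mul_sum]
    rw [intervalIntegral.integral_finsetSum]
    · apply Finset.sum_congr rfl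
      intro i hi
      rw [← intervalIntegral.integral_const_mul]
      have hi' : (i:ℝ) + 1 ≤ lam := by exact_mod_cast Finset.mem_range.1 hi
      have c : ∀ t : ℝ, t ^ N * (D i * g (t - lam * i))
          = (fun s => D i * ((s + lam * i) ^ N * g s)) (t - lam * i) := by
        intro t; simp only [sub_add_cancel]; ring
      simp only [c]
      rw [intervalIntegral.integral_comp_sub_right (fun s => D i * ((s + lam * i) ^ N * g s))]
      set q : ℝ → ℝ := fun s => D i * ((s + lam * i) ^ N * g s) with hq
      have qc : Continuous q := by rw [hq]; fun_prop
      have qi : ∀ a b, IntervalIntegrable q volume a b := fun a b => qc.intervalIntegrable a b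
      rw [← intervalIntegral.integral_add_adjacent_intervals (qi _ 0) (qi 0 _),
        ← intervalIntegral.integral_add_adjacent_intervals (qi 0 lam) (qi lam _)]
      have z1 : ∫ s in (0 - (lam:ℝ) * i)..0, q s = 0 := by
        rw [intervalIntegral.integral_congr (g := fun _ => (0:ℝ))]
        · simp
        · intro s hs
          rw [Set.uIcc_of_le (by have : (0:ℝ) ≤ lam * i := by positivity
                                 linarith)] at hs
          simp [hq, hg0 s hs.2]
      have z2 : ∫ s in (lam:ℝ)..((lam:ℝ) * lam - lam * i), q s = 0 := by
        rw [intervalIntegral.integral_congr (g := fun _ => (0:ℝ))]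
        · simp
        · intro s hs
          rw [Set.uIcc_of_le (by nlinarith)] at hs
          simp [hq, hg1 s hs.1]
      rw [z1, z2]; ring
    · intro i _
      apply Continuous.intervalIntegrable
      fun_prop
  have B : ∀ i : ℕ, ∫ s in (0:ℝ)..lam, (s + lam * i) ^ N * g s
      = ∫ s in (0:ℝ)..lam, s ^ N * g s := by
    intro i
    simp only [add_pow, Finset.sum_mul]
    rw [intervalIntegral.integral_finsetSum]
    · rw [Finset.sum_range_succ, Finset.sum_eq_zero]
      · simp
      · intro k hk
        have e := intervalIntegral.integral_const_mul (μ := volume) (a := 0) (b := (lam:ℝ))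
          (((lam:ℝ) * i) ^ (N - k) * (N.choose k)) (fun s => s ^ k * g s)
        rw [ih k (Finset.mem_range.1 hk), mul_zero] at e
        rw [← e]
        congr 1; ext s; ring
    · intro k _
      apply Continuous.intervalIntegrable
      fun_prop
  have C : ∫ t in (0:ℝ)..(lam * lam), t ^ N * h t = 0 := by
    have hend : ∫ t in (0:ℝ)..(lam * lam), h t = 0 := by
      rw [hE lam ⟨hl.le, le_rfl⟩, hg1 _ le_rfl, mul_zero]
    cases N with
    | zero => simpa using hend
    | succ N =>
      set H : ℝ → ℝ := fun u => ∫ t in (0:ℝ)..u, h t with hH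
      have hd : ∀ u, HasDerivAt H (h u) u := fun u =>
        intervalIntegral.integral_hasDerivAt_right (hhc.intervalIntegrable _ _)
          (hhc.stronglyMeasurableAtFilter _ _) hhc.continuousAt
      have hHc : Continuous H := continuous_iff_continuousAt.2 fun u => (hd u).continuousAt
      have ip := intervalIntegral.integral_mul_deriv_eq_deriv_mul (a := 0) (b := (lam:ℝ) * lam)
        (u := fun t => t ^ (N+1)) (u' := fun t => ((N+1 : ℕ):ℝ) * t ^ N) (v := H) (v' := h)
        (fun t _ => by simpa using hasDerivAt_pow (N+1) t) (fun t _ => hd t)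
        (by apply Continuous.intervalIntegrable; fun_prop) (hhc.intervalIntegrable _ _)
      rw [ip]
      have e1 : H (lam * lam) = 0 := hend
      have e2 : ∫ t in (0:ℝ)..(lam * lam), ((N+1 : ℕ):ℝ) * t ^ N * H t = 0 := by
        have sc := intervalIntegral.mul_integral_comp_mul_left (a := 0) (b := (lam:ℝ))
          (f := fun t => ((N+1 : ℕ):ℝ) * t ^ N * H t) (lam:ℝ)
        rw [mul_zero] at sc
        rw [← sc, intervalIntegral.integral_congr
          (g := fun y => (((N+1:ℕ):ℝ) * (lam:ℝ)^N * δ) * (y ^ N * g y)),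
          intervalIntegral.integral_const_mul, ih N (by omega)]
        · simp
        · intro y hy
          rw [Set.uIcc_of_le hl.le] at hy
          have : H (lam * y) = δ * g y := hE y hy
          simp only [this]; ring
      rw [e1, e2]; simp
  rw [A] at C
  simp only [B] at C
  rw [← Finset.sum_mul] at C
  exact (mul_eq_zero.1 C).resolve_left hD

lemma zero_of_int (L : ℝ) (v : ℝ → ℝ) (hv : ContinuousOn v (Set.Icc 0 L))
    (hi : ∀ z ∈ Set.Icc 0 L, ∫ t in (0:ℝ)..z, v t = 0) : ∀ z ∈ Set.Ioo 0 L, v z = 0 := by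
  intro z hz
  have hn : Set.Icc 0 L ∈ nhds z := Icc_mem_nhds hz.1 hz.2
  have hca : ContinuousAt v z := hv.continuousAt hn
  have h1 : HasDerivAt (fun u => ∫ t in (0:ℝ)..u, v t) (v z) z := by
    apply intervalIntegral.integral_hasDerivAt_right
    · apply ContinuousOn.intervalIntegrable
      apply hv.mono
      rw [Set.uIcc_of_le hz.1.le]
      exact Set.Icc_subset_Icc_right hz.2.le
    · exact (hv.mono Set.Ioo_subset_Icc_self).stronglyMeasurableAtFilter isOpen_Ioo z hz
    · exact hca
  have h2 : HasDerivAt (fun u => ∫ t in (0:ℝ)..u, v t) 0 z := by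
    apply (hasDerivAt_const z (0:ℝ)).congr_of_eventuallyEq
    filter_upwards [hn] with u hu using hi u hu
  exact h1.unique h2

lemma pick_sub (fa fb : ℝ → ℝ) (c d : AB) (s : ℝ) : pickF fa fb c s - pickF fa fb d s
    = ((if c = AB.a then (1:ℝ) else 0) - (if d = AB.a then (1:ℝ) else 0)) * (fa s - fb s) := by
  cases c <;> cases d <;> simp [pickF]

/-- **Theorem 3.** If the concatenation `f = f_w` of `fa`, `fb` along `w` is a nonzero
solution of `(E_{λ,δ})`, then there is a unique `λ`-uniform substitution `σ` with
`σ(w) = w`; moreover `|σ(a)|_a = |σ(b)|_a` and the functions `f_{σ(a)}`, `f_{σ(b)}`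
satisfy the stated integral identities. -/
theorem concat_solution_substitutive (lam : ℕ) (hlam : 2 ≤ lam) (δ : ℝ) (hδ : δ ≠ 0)
    (fa fb : ℝ → ℝ)
    (hfa : ContinuousOn fa (Set.Icc 0 (lam : ℝ)))
    (hfb : ContinuousOn fb (Set.Icc 0 (lam : ℝ)))
    (hb1 : fa 0 = fa (lam : ℝ)) (hb2 : fa 0 = fb 0) (hb3 : fa 0 = fb (lam : ℝ))
    (w : ℕ → AB)
    (hsol : IsSolution (lam : ℝ) δ (concatW (lam : ℝ) fa fb w))
    (hnz : ¬ ∀ x : ℝ, 0 ≤ x → concatW (lam : ℝ) fa fb w x = 0) :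
    ∃ σ : AB → List AB,
      ((σ AB.a).length = lam ∧ (σ AB.b).length = lam ∧ SubFix σ w) ∧
      (∀ σ' : AB → List AB,
        ((σ' AB.a).length = lam ∧ (σ' AB.b).length = lam ∧ SubFix σ' w) → σ' = σ) ∧
      (σ AB.a).count AB.a = (σ AB.b).count AB.a ∧
      (∀ x ∈ Set.Icc (0:ℝ) (lam : ℝ), ∀ y ∈ Set.Icc (0:ℝ) (lam : ℝ),
        (∫ t in ((lam : ℝ) * x)..((lam : ℝ) * y), concatL (lam : ℝ) fa fb (σ AB.a) t)
          = δ * (fa y - fa x)) ∧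
      (∀ x ∈ Set.Icc (0:ℝ) (lam : ℝ), ∀ y ∈ Set.Icc (0:ℝ) (lam : ℝ),
        (∫ t in ((lam : ℝ) * x)..((lam : ℝ) * y), concatL (lam : ℝ) fa fb (σ AB.b) t)
          = δ * (fb y - fb x)) := by
  have hl : (0:ℝ) < lam := by positivity
  set f := concatW (lam : ℝ) fa fb w with hfdef
  have hf : ∀ (n : ℕ) (s : ℝ), 0 ≤ s → s ≤ lam → f (lam * n + s) = pickF fa fb (w n) s :=
    fun n s h0 h1 => concatW_le hl hb1 hb2 hb3 w n s h0 h1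
  have hnper : ¬ ∀ x, 0 ≤ x → f (x + lam) = f x :=
    fun h => hnz (periodic_const lam hlam δ hδ f hsol h)
  have hper_of : (∀ n m s, 0 ≤ s → s ≤ (lam:ℝ) → pickF fa fb (w n) s = pickF fa fb (w m) s) →
      False := by
    intro h
    apply hnper
    intro x hx
    obtain ⟨n, s, h0, h1, rfl⟩ := exists_block lam hl x hx
    rw [show (lam:ℝ) * n + s + lam = lam * ((n+1 : ℕ):ℝ) + s by push_cast; ring,
      hf _ _ h0 h1.le, hf _ _ h0 h1.le]
    exact h _ _ _ h0 h1.le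
  have hne : ¬ ∀ s ∈ Set.Icc (0:ℝ) lam, fa s = fb s := by
    intro h
    apply hper_of
    intro n m s h0 h1
    have := h s ⟨h0, h1⟩
    cases w n <;> cases w m <;> simp [pickF, this]
  have hocc : ∀ c, ∃ n, w n = c := by
    intro c
    by_contra hcon
    push Not at hcon
    apply hper_of
    intro n m s _ _
    have : w n = w m := by
      have h1 := hcon n
      have h2 := hcon m
      revert h1 h2
      cases c <;> cases w n <;> cases w m <;> simp
    rw [this]
  obtain ⟨hfc, hfE⟩ := hsol
  set B : ℕ → List AB := fun n => List.ofFn (fun i : Fin lam => w (lam * n + i)) with hB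
  have hBlen : ∀ n, (B n).length = lam := fun n => by simp [hB]
  have hBget : ∀ n, ∀ i < lam, (B n).getD i AB.a = w (lam * n + i) := by
    intro n i hi
    rw [List.getD_eq_getElem _ _ (by rw [hBlen]; exact hi)]
    simp [hB]
  have hend : ∀ u : List AB, concatL lam fa fb u ((lam:ℝ) * lam) = fa 0 := by
    intro u
    have := concatL_lt lam hl fa fb u lam 0 le_rfl hl
    rw [pick_zero hb2, add_zero] at this
    exact this
  have hblk : ∀ t : ℝ, 0 ≤ t → t < lam * lam →
      ∃ m : ℕ, m < lam ∧ ∃ s : ℝ, 0 ≤ s ∧ s < lam ∧ t = lam * m + s := by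
    intro t h0 h1
    obtain ⟨m, s, hs0, hs1, rfl⟩ := exists_block lam hl t h0
    refine ⟨m, ?_, s, hs0, hs1, rfl⟩
    have : (lam:ℝ) * m < lam * lam := by linarith
    exact_mod_cast lt_of_mul_lt_mul_left this hl.le
  have hBf : ∀ n : ℕ, ∀ t ∈ Set.Icc (0:ℝ) (lam * lam),
      concatL lam fa fb (B n) t = f (lam * (lam * n) + t) := by
    intro n t ht
    rcases ht.2.lt_or_eq with h | rfl
    · obtain ⟨m, hm, s, hs0, hs1, rfl⟩ := hblk t ht.1 h
      rw [concatL_lt lam hl fa fb _ m s hs0 hs1, hBget n m hm,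
        show (lam:ℝ) * (lam * n) + (lam * m + s) = lam * ((lam * n + m : ℕ):ℝ) + s by
          push_cast; ring, hf _ _ hs0 hs1.le]
    · rw [hend, show (lam:ℝ) * (lam * n) + lam * lam = lam * ((lam * n + lam : ℕ):ℝ) + 0 by
          push_cast; ring, hf _ _ le_rfl hl.le, pick_zero hb2]
  have hBc : ∀ n : ℕ, ContinuousOn (concatL lam fa fb (B n)) (Set.Icc (0:ℝ) (lam * lam)) := by
    intro n
    have : ContinuousOn (fun t => f ((lam:ℝ) * (lam * n) + t)) (Set.Icc (0:ℝ) (lam * lam)) := by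
      apply hfc.comp (by fun_prop)
      intro t ht
      have := ht.1
      show (0:ℝ) ≤ _
      positivity
    exact this.congr (hBf n)
  have hscale : ∀ x ∈ Set.Icc (0:ℝ) lam, (lam:ℝ) * x ∈ Set.Icc (0:ℝ) (lam * lam) :=
    fun x hx => ⟨mul_nonneg hl.le hx.1, mul_le_mul_of_nonneg_left hx.2 hl.le⟩
  have hBii : ∀ n : ℕ, ∀ x ∈ Set.Icc (0:ℝ) (lam * lam), ∀ y ∈ Set.Icc (0:ℝ) (lam * lam),
      IntervalIntegrable (concatL lam fa fb (B n)) volume x y := by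
    intro n x hx y hy
    exact ((hBc n).mono (Set.uIcc_subset_Icc hx hy)).intervalIntegrable
  have hfint : ∀ a b : ℝ, 0 ≤ a → 0 ≤ b → IntervalIntegrable f volume a b := by
    intro a b ha hb
    apply ContinuousOn.intervalIntegrable
    apply hfc.mono
    intro x hx
    exact le_trans (le_min ha hb) hx.1
  have hBi : ∀ n : ℕ, ∀ x ∈ Set.Icc (0:ℝ) lam, ∀ y ∈ Set.Icc (0:ℝ) lam,
      ∫ t in ((lam:ℝ) * x)..(lam * y), concatL lam fa fb (B n) t
        = δ * (pickF fa fb (w n) y - pickF fa fb (w n) x) := by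
    intro n x hx y hy
    rw [intervalIntegral.integral_congr (g := fun t => f ((lam:ℝ) * (lam * n) + t))]
    · rw [intervalIntegral.integral_comp_add_left]
      have hx0 := hx.1
      have hy0 := hy.1
      have e1 := hfE (lam * n + x) (by positivity)
      have e2 := hfE (lam * n + y) (by positivity)
      have e3 := intervalIntegral.integral_interval_sub_left
        (hfint 0 (lam * (lam * n + y)) le_rfl (by positivity))
        (hfint 0 (lam * (lam * n + x)) le_rfl (by positivity))
      rw [e1, e2, hf n x hx.1 hx.2, hf n y hy.1 hy.2] at e3
      rw [← mul_add, ← mul_add, ← e3]; ring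
    · intro t ht
      exact hBf n t (Set.uIcc_subset_Icc (hscale x hx) (hscale y hy) ht)
  have h00 : (0:ℝ) ∈ Set.Icc (0:ℝ) lam := ⟨le_rfl, hl.le⟩
  have h0L : (0:ℝ) ∈ Set.Icc (0:ℝ) (lam * lam) := ⟨le_rfl, by positivity⟩
  have hBeq : ∀ n m, w n = w m → B n = B m := by
    intro n m hnm
    apply ext_getD _ _ (by rw [hBlen, hBlen])
    intro i hi
    rw [hBlen] at hi
    by_contra hcon
    apply hne
    have hz := zero_of_int ((lam:ℝ) * lam)
      (fun t => concatL lam fa fb (B n) t - concatL lam fa fb (B m) t)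
      ((hBc n).sub (hBc m)) (by
        intro z hz
        rw [intervalIntegral.integral_sub (hBii n 0 h0L z hz) (hBii m 0 h0L z hz)]
        have hz' : z / lam ∈ Set.Icc (0:ℝ) lam :=
          ⟨div_nonneg hz.1 hl.le, by rw [div_le_iff₀ hl]; exact hz.2⟩
        have e1 := hBi n 0 h00 _ hz'
        have e2 := hBi m 0 h00 _ hz'
        rw [mul_zero, mul_div_cancel₀ _ hl.ne'] at e1 e2
        rw [e1, e2, hnm, sub_self])
    intro s hs
    rcases hs.1.eq_or_lt with rfl | h0
    · exact hb2
    rcases hs.2.eq_or_lt with rfl | h1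
    · rw [← hb1, ← hb3]
    have hi' : (i:ℝ) + 1 ≤ lam := by exact_mod_cast hi
    have := hz (lam * i + s) ⟨by positivity, by nlinarith⟩
    simp only [concatL_lt lam hl fa fb _ i s hs.1 h1] at this
    rw [pick_sub] at this
    revert this hcon
    cases (B n).getD i AB.a <;> cases (B m).getD i AB.a <;> simp
    · intro h; linarith
    · intro h; linarith
  choose idx hidx using hocc
  have hσw : ∀ n, B (idx (w n)) = B n := fun n => hBeq _ _ (hidx _)
  refine ⟨fun c => B (idx c), ⟨hBlen _, hBlen _, ?_⟩, ?_, ?_, ?_, ?_⟩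
  · rw [subFix_iff lam (by omega) _ (fun c => hBlen _)]
    intro n i hi
    simp only [hσw]
    exact hBget n i hi
  · rintro σ' ⟨ha, hb, hfix⟩
    have hlen : ∀ c, (σ' c).length = lam := by
      intro c
      cases c
      · exact ha
      · exact hb
    rw [subFix_iff lam (by omega) _ hlen] at hfix
    funext c
    apply ext_getD _ _ (by rw [hlen, hBlen])
    intro i hi
    rw [hlen] at hi
    have := hfix (idx c) i hi
    rw [hidx] at this
    rw [this, hBget _ _ hi]
  · by_contra hcount
    apply hne
    set p := idx AB.a
    set q := idx AB.b
    set g : ℝ → ℝ := fun t => fa (max 0 (min t lam)) - fb (max 0 (min t lam)) with hg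
    set D : ℕ → ℝ := fun i => (if (B p).getD i AB.a = AB.a then (1:ℝ) else 0)
      - (if (B q).getD i AB.a = AB.a then (1:ℝ) else 0) with hD
    have hgI : ∀ t ∈ Set.Icc (0:ℝ) lam, g t = fa t - fb t := by
      intro t ht
      simp only [hg, min_eq_left ht.2, max_eq_right ht.1]
    have hg0 : ∀ t ≤ 0, g t = 0 := by
      intro t ht
      simp only [hg, min_eq_left (ht.trans hl.le), max_eq_left ht, hb2, sub_self]
    have hg1 : ∀ t, (lam:ℝ) ≤ t → g t = 0 := by
      intro t ht
      simp only [hg, min_eq_right ht, max_eq_right hl.le, ← hb1, ← hb3, sub_self]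
    have hgc : Continuous g := by
      have hm : ∀ t : ℝ, max 0 (min t lam) ∈ Set.Icc (0:ℝ) lam :=
        fun t => ⟨le_max_left _ _, max_le hl.le (min_le_right _ _)⟩
      exact (hfa.comp_continuous (by fun_prop) hm).sub (hfb.comp_continuous (by fun_prop) hm)
    have hzero := sum_zero lam hlam δ g hgc hg0 hg1 D (by
      intro y hy
      have hyL := hscale y hy
      have e1 := hBi p 0 h00 y hy
      have e2 := hBi q 0 h00 y hy
      rw [mul_zero] at e1 e2
      rw [hidx, pick_zero hb2] at e1 e2
      rw [intervalIntegral.integral_congr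
        (g := fun t => concatL lam fa fb (B p) t - concatL lam fa fb (B q) t),
        intervalIntegral.integral_sub (hBii p 0 h0L _ hyL) (hBii q 0 h0L _ hyL), e1, e2,
        hgI y hy]
      · simp only [pickF]; ring
      · intro t ht
        have ht' := Set.uIcc_subset_Icc h0L hyL ht
        show ∑ i ∈ Finset.range lam, D i * g (t - lam * i)
          = concatL lam fa fb (B p) t - concatL lam fa fb (B q) t
        rcases ht'.2.lt_or_eq with h | rfl
        · obtain ⟨m, hm, s, hs0, hs1, rfl⟩ := hblk t ht'.1 h
          rw [concatL_lt lam hl fa fb _ m s hs0 hs1, concatL_lt lam hl fa fb _ m s hs0 hs1,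
            pick_sub, ← hgI s ⟨hs0, hs1.le⟩,
            Finset.sum_eq_single_of_mem m (Finset.mem_range.2 hm)]
          · rw [add_sub_cancel_left]
          · intro i _ him
            rcases lt_or_gt_of_ne him with h | h
            · have : (i:ℝ) + 1 ≤ m := by exact_mod_cast h
              rw [hg1 _ (by nlinarith), mul_zero]
            · have : (m:ℝ) + 1 ≤ i := by exact_mod_cast h
              rw [hg0 _ (by nlinarith), mul_zero]
        · rw [hend, hend, sub_self]
          apply Finset.sum_eq_zero
          intro i hi
          have hi' : (i:ℝ) + 1 ≤ lam := by exact_mod_cast Finset.mem_range.1 hi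
          rw [hg1 _ (by nlinarith), mul_zero])
      (by
        intro hs
        apply hcount
        simp only [hD] at hs
        rw [Finset.sum_sub_distrib] at hs
        have c1 := count_getD (B p)
        have c2 := count_getD (B q)
        rw [hBlen] at c1 c2
        have : ((B p).count AB.a : ℝ) = (B q).count AB.a := by linarith
        exact_mod_cast this)
    intro s hs
    have := hzero s hs
    rw [hgI s hs] at this
    linarith
  · intro x hx y hy
    have := hBi (idx AB.a) x hx y hy
    rw [hidx] at this
    exact this
  · intro x hx y hy
    have := hBi (idx AB.b) x hx y hy
    rw [hidx] at this
    exact this
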